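/- arXiv:1405.4697 — 6 statements merged into one kernel-verified Lean document; each statement's English description precedes it below -/
import Mathlib

section
/- Let S be a finite set of at least two switches placed on one ring space via an injective coordinate map χ : S → [0,1), and let x ∈ [0,1) be any coordinate. If a switch s ∈ S does not attain the minimum circular distance to x over S (i.e., there exists w ∈ S with CD(χ(w), x) < CD(χ(s), x)), then s has a ring-adjacent switch s' ∈ S with CD(χ(s'), x) < CD(χ(s), x). -/
/-- Circular distance on the unit circle `[0,1)` with circumference 1. -/
noncomputable def CD (x y : ℝ) : ℝ := min |x - y| (1 - |x - y|)

/-- `inArc a b c` : the point `c` lies strictly inside the open circular arc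
going from `a` in the positive direction to `b` (coordinates mod 1). -/
def inArc (a b c : ℝ) : Prop :=
  0 < Int.fract (c - a) ∧ Int.fract (c - a) < Int.fract (b - a)

/-- Two points `p ≠ q` of a set `Q` of coordinates are circularly (ring-)adjacent in `Q`
if one of the two open circular arcs between them contains no point of `Q`. -/
def RingAdj (Q : Set ℝ) (p q : ℝ) : Prop :=
  p ∈ Q ∧ q ∈ Q ∧ p ≠ q ∧
    ((∀ r ∈ Q, ¬ inArc p q r) ∨ (∀ r ∈ Q, ¬ inArc q p r))

theorem fract_sub_of_mem {a c : ℝ} (ha : a ∈ Set.Ico (0 : ℝ) 1) (hc : c ∈ Set.Ico (0 : ℝ) 1) :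
    Int.fract (c - a) = if a ≤ c then c - a else c - a + 1 := by
  obtain ⟨ha0, ha1⟩ := ha
  obtain ⟨hc0, hc1⟩ := hc
  split_ifs with h
  · exact Int.fract_eq_self.2 ⟨by linarith, by linarith⟩
  · rw [← Int.fract_add_one]
    exact Int.fract_eq_self.2 ⟨by linarith, by linarith⟩

theorem closer_iff_low {s c x : ℝ} (hs : s ∈ Set.Ico (0 : ℝ) 1) (hc : c ∈ Set.Ico (0 : ℝ) 1)
    (hx : x ∈ Set.Ico (0 : ℝ) 1) (h : Int.fract (x - s) ≤ 1 / 2) :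
    CD c x < CD s x ↔ 0 < Int.fract (c - s) ∧ Int.fract (c - s) < 2 * Int.fract (x - s) := by
  rw [fract_sub_of_mem hs hx] at *
  rw [fract_sub_of_mem hs hc]
  obtain ⟨hs0, hs1⟩ := hs
  obtain ⟨hc0, hc1⟩ := hc
  obtain ⟨hx0, hx1⟩ := hx
  unfold CD
  grind

theorem closer_iff_high {s c x : ℝ} (hs : s ∈ Set.Ico (0 : ℝ) 1) (hc : c ∈ Set.Ico (0 : ℝ) 1)
    (hx : x ∈ Set.Ico (0 : ℝ) 1) (h : 1 / 2 ≤ Int.fract (x - s)) :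
    CD c x < CD s x ↔ 2 * Int.fract (x - s) - 1 < Int.fract (c - s) ∧ 0 < Int.fract (c - s) := by
  rw [fract_sub_of_mem hs hx] at *
  rw [fract_sub_of_mem hs hc]
  obtain ⟨hs0, hs1⟩ := hs
  obtain ⟨hc0, hc1⟩ := hc
  obtain ⟨hx0, hx1⟩ := hx
  unfold CD
  grind

/-- **Lemma 1.** In one ring space with at least two switches and an
injective coordinate map `χ : S → [0,1)`, if switch `s` does not attain the minimum
circular distance to a coordinate `x` over all switches, then `s` has a ring-adjacent
switch `s'` with `CD (χ s') x < CD (χ s) x`. -/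
theorem stmt_0 {S : Type*} [Fintype S] (hcard : 2 ≤ Fintype.card S)
    (χ : S → ℝ) (hmem : ∀ s, χ s ∈ Set.Ico (0 : ℝ) 1) (hinj : Function.Injective χ)
    (x : ℝ) (hx : x ∈ Set.Ico (0 : ℝ) 1)
    (s : S) (hnotmin : ∃ w : S, CD (χ w) x < CD (χ s) x) :
    ∃ s' : S, RingAdj (Set.range χ) (χ s) (χ s') ∧ CD (χ s') x < CD (χ s) x := by
  classical
  obtain ⟨w, hw⟩ := hnotmin
  rcases le_total (Int.fract (x - χ s)) (1 / 2) with h | h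
  · have hwl := (closer_iff_low (hmem s) (hmem w) hx h).1 hw
    obtain ⟨t, ht, hmin⟩ := Finset.exists_min_image
      (Finset.univ.filter fun c => 0 < Int.fract (χ c - χ s)) (fun c => Int.fract (χ c - χ s))
      ⟨w, by simpa using hwl.1⟩
    have ht0 : 0 < Int.fract (χ t - χ s) := (Finset.mem_filter.1 ht).2
    have htw := hmin w (Finset.mem_filter.2 ⟨Finset.mem_univ _, hwl.1⟩)
    have hcl := (closer_iff_low (hmem s) (hmem t) hx h).2 ⟨ht0, lt_of_le_of_lt htw hwl.2⟩
    refine ⟨t, ⟨⟨s, rfl⟩, ⟨t, rfl⟩, ?_, Or.inl ?_⟩, hcl⟩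
    · intro e
      rw [e] at hcl
      exact lt_irrefl _ hcl
    · rintro _ ⟨r, rfl⟩ ⟨h1, h2⟩
      exact absurd (hmin r (Finset.mem_filter.2 ⟨Finset.mem_univ _, h1⟩)) (not_le.2 h2)
  · have hwl := (closer_iff_high (hmem s) (hmem w) hx h).1 hw
    obtain ⟨t, -, hmax⟩ := Finset.exists_max_image
      (Finset.univ : Finset S) (fun c => Int.fract (χ c - χ s)) ⟨w, Finset.mem_univ _⟩
    have htw := hmax w (Finset.mem_univ _)
    have hcl := (closer_iff_high (hmem s) (hmem t) hx h).2
      ⟨lt_of_lt_of_le hwl.1 htw, lt_of_lt_of_le hwl.2 htw⟩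
    have hne : χ s ≠ χ t := by
      intro e
      rw [e] at hcl
      exact lt_irrefl _ hcl
    refine ⟨t, ⟨⟨s, rfl⟩, ⟨t, rfl⟩, hne, Or.inr ?_⟩, hcl⟩
    rintro _ ⟨r, rfl⟩ ⟨h1, h2⟩
    have hr := hmax r (Finset.mem_univ _)
    simp only [fract_sub_of_mem (hmem _) (hmem _)] at h1 h2 hr
    obtain ⟨hs0, hs1⟩ := hmem s
    obtain ⟨ht0, ht1⟩ := hmem t
    obtain ⟨hr0, hr1⟩ := hmem r
    clear hcl hwl htw hmax
    grind
end

section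
/- In an S2 topology with L ≥ 1 spaces, let s and t be distinct switches, and let v be a graph neighbor of s that minimizes MCD(χ(v), χ(t)) among all graph neighbors of s. Then MCD(χ(v), χ(t)) < MCD(χ(s), χ(t)). -/
/-- Minimum circular distance between two `L`-dimensional coordinate vectors. -/
noncomputable def MCD {L : ℕ} (X Y : Fin L → ℝ) : ℝ := ⨅ i, CD (X i) (Y i)

theorem fract_sub_ico {x y : ℝ} (hx : x ∈ Set.Ico (0 : ℝ) 1) (hy : y ∈ Set.Ico (0 : ℝ) 1) :
    Int.fract (y - x) = if x ≤ y then y - x else y - x + 1 := by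
  obtain ⟨h1, h2⟩ := hx
  obtain ⟨h3, h4⟩ := hy
  split_ifs with h
  · rw [Int.fract_eq_iff]
    exact ⟨by linarith, by linarith, 0, by simp⟩
  · rw [Int.fract_eq_iff]
    push Not at h
    exact ⟨by linarith, by linarith, -1, by push_cast; ring⟩

theorem exists_closer {S : Type*} [Fintype S] (f : S → ℝ)
    (hmem : ∀ s, f s ∈ Set.Ico (0 : ℝ) 1) (hinj : Function.Injective f)
    (s t : S) (hst : s ≠ t) :
    ∃ u, s ≠ u ∧ RingAdj (Set.range f) (f s) (f u) ∧ CD (f u) (f t) < CD (f s) (f t) := by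
  classical
  have hne : (Finset.univ.filter (fun u => s ≠ u)).Nonempty := ⟨t, by simp [hst]⟩
  have hfst : f s ≠ f t := fun h => hst (hinj h)
  have hs := hmem s
  have ht := hmem t
  by_cases hc : Int.fract (f t - f s) ≤ 1 / 2
  · obtain ⟨u, hu, hmin⟩ := Finset.exists_min_image _ (fun u => Int.fract (f u - f s)) hne
    simp only [Finset.mem_filter, Finset.mem_univ, true_and] at hu hmin
    have hfu : f s ≠ f u := fun h => hu (hinj h)
    have hum := hmem u
    refine ⟨u, hu, ⟨⟨s, rfl⟩, ⟨u, rfl⟩, hfu, Or.inl ?_⟩, ?_⟩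
    · rintro _ ⟨r, rfl⟩ ⟨h0, h1⟩
      have hsr : s ≠ r := by
        rintro rfl
        simp at h0
      exact absurd (hmin r hsr) (not_le.mpr h1)
    · have hm := hmin t hst
      rw [fract_sub_ico hs ht] at hc hm
      rw [fract_sub_ico hs hum] at hm
      obtain ⟨a1, a2⟩ := hs
      obtain ⟨b1, b2⟩ := ht
      obtain ⟨c1, c2⟩ := hum
      unfold CD
      grind
  · obtain ⟨u, hu, hmin⟩ := Finset.exists_min_image _ (fun u => Int.fract (f s - f u)) hne
    simp only [Finset.mem_filter, Finset.mem_univ, true_and] at hu hmin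
    have hfu : f s ≠ f u := fun h => hu (hinj h)
    have hum := hmem u
    refine ⟨u, hu, ⟨⟨s, rfl⟩, ⟨u, rfl⟩, hfu, Or.inr ?_⟩, ?_⟩
    · rintro _ ⟨r, rfl⟩ ⟨h0, h1⟩
      have hsr : s ≠ r := by
        rintro rfl
        simp at h1
      have hm := hmin r hsr
      have hr := hmem r
      rw [fract_sub_ico hum hr] at h0 h1
      rw [fract_sub_ico hum hs] at h1 hm
      rw [fract_sub_ico hr hs] at hm
      obtain ⟨a1, a2⟩ := hs
      obtain ⟨b1, b2⟩ := hr
      obtain ⟨c1, c2⟩ := hum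
      grind
    · have hm := hmin t hst
      rw [fract_sub_ico hs ht] at hc
      rw [fract_sub_ico hum hs, fract_sub_ico ht hs] at hm
      obtain ⟨a1, a2⟩ := hs
      obtain ⟨b1, b2⟩ := ht
      obtain ⟨c1, c2⟩ := hum
      unfold CD
      grind

/-- **Lemma 2.** In an S2 topology with `L ≥ 1` spaces, if `s ≠ t` and
`v` is a graph neighbor of `s` minimizing the MCD to `χ(t)` among all graph neighbors
of `s`, then `MCD (χ v) (χ t) < MCD (χ s) (χ t)`. -/
theorem stmt_1 {S : Type*} [Fintype S] {L : ℕ} (hL : 1 ≤ L)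
    (χ : Fin L → S → ℝ)
    (hmem : ∀ (i : Fin L) (s : S), χ i s ∈ Set.Ico (0 : ℝ) 1)
    (hinj : ∀ i : Fin L, Function.Injective (χ i))
    (G : SimpleGraph S)
    (hG : ∀ (i : Fin L) (u v : S), u ≠ v →
      RingAdj (Set.range (χ i)) (χ i u) (χ i v) → G.Adj u v)
    (s t : S) (hst : s ≠ t)
    (v : S) (hv : G.Adj s v)
    (hvmin : ∀ u : S, G.Adj s u →
      MCD (fun i => χ i v) (fun i => χ i t) ≤ MCD (fun i => χ i u) (fun i => χ i t)) :
    MCD (fun i => χ i v) (fun i => χ i t) < MCD (fun i => χ i s) (fun i => χ i t) := by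
  haveI : Nonempty (Fin L) := ⟨⟨0, hL⟩⟩
  obtain ⟨i, hi⟩ := exists_eq_ciInf_of_finite (f := fun i => CD (χ i s) (χ i t))
  obtain ⟨u, hsu, hadj, hlt⟩ := exists_closer (χ i) (hmem i) (hinj i) s t hst
  calc MCD (fun i => χ i v) (fun i => χ i t)
      ≤ MCD (fun i => χ i u) (fun i => χ i t) := hvmin u (hG i s u hsu hadj)
    _ ≤ CD (χ i u) (χ i t) :=
        ciInf_le (f := fun i => CD (χ i u) (χ i t)) (Set.finite_range _).bddBelow i
    _ < CD (χ i s) (χ i t) := hlt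
    _ = MCD (fun i => χ i s) (fun i => χ i t) := hi
end

section
/- In an S2 topology with L ≥ 1 spaces and switch set S, fix a destination switch t. Consider any sequence s_0, s_1, … of switches such that whenever s_j ≠ t, the next switch s_{j+1} is a graph neighbor of s_j minimizing MCD(χ(·), χ(t)) among all graph neighbors of s_j (greediest routing). Then for every starting switch s_0 there exists k ≤ |S| − 1 with s_k = t, and the switches s_0, s_1, …, s_k are pairwise distinct; that is, greediest routing finds a loop-free path of a finite number of hops to any destination. -/
theorem aux_fract {a b : ℝ} (ha : a ∈ Set.Ico (0:ℝ) 1) (hb : b ∈ Set.Ico (0:ℝ) 1) :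
    (b ≤ a ∧ Int.fract (a - b) = a - b) ∨ (a < b ∧ Int.fract (a - b) = a - b + 1) := by
  obtain ⟨ha0, ha1⟩ := ha
  obtain ⟨hb0, hb1⟩ := hb
  rcases le_or_gt b a with h | h
  · left
    exact ⟨h, Int.fract_eq_self.2 ⟨by linarith, by linarith⟩⟩
  · right
    refine ⟨h, ?_⟩
    rw [Int.fract_eq_iff]
    exact ⟨by linarith, by linarith, -1, by push_cast; ring⟩

theorem aux_CD {a b : ℝ} (ha : a ∈ Set.Ico (0:ℝ) 1) (hb : b ∈ Set.Ico (0:ℝ) 1) (hab : a ≠ b) :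
    CD a b = min (Int.fract (a - b)) (Int.fract (b - a)) := by
  unfold CD
  rcases lt_or_gt_of_ne hab with h | h
  · rw [abs_of_neg (by linarith), min_comm]
    rcases aux_fract ha hb with h1 | h1 <;> rcases aux_fract hb ha with h2 | h2 <;>
      first | (exfalso; linarith [h1.1, h2.1]) | (rw [h1.2, h2.2]; congr 1 <;> ring)
  · rw [abs_of_pos (by linarith)]
    rcases aux_fract ha hb with h1 | h1 <;> rcases aux_fract hb ha with h2 | h2 <;>
      first | (exfalso; linarith [h1.1, h2.1]) | (rw [h1.2, h2.2]; congr 1; ring)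

theorem aux_CD_self (a : ℝ) : CD a a = 0 := by simp [CD]

theorem aux_pos {a b : ℝ} (ha : a ∈ Set.Ico (0:ℝ) 1) (hb : b ∈ Set.Ico (0:ℝ) 1) (hab : a ≠ b) :
    0 < Int.fract (a - b) := by
  rcases aux_fract ha hb with h | h
  · rw [h.2]
    have := lt_of_le_of_ne h.1 hab.symm
    linarith
  · rw [h.2]
    linarith [ha.1, hb.2]

/-- If going forward from `a`, `b` comes no later than `c`, lengths add. -/
theorem aux_sub (a b c : ℝ) (h : Int.fract (b - a) ≤ Int.fract (c - a)) :
    Int.fract (c - b) = Int.fract (c - a) - Int.fract (b - a) := by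
  rw [Int.fract_eq_iff]
  refine ⟨by linarith, by linarith [Int.fract_lt_one (c - a), Int.fract_nonneg (b - a)],
    ⌊c - a⌋ - ⌊b - a⌋, ?_⟩
  unfold Int.fract
  push_cast
  ring

/-- The same, measured backwards. -/
theorem aux_sub' (a b c : ℝ) (h : Int.fract (a - b) ≤ Int.fract (a - c)) :
    Int.fract (b - c) = Int.fract (a - c) - Int.fract (a - b) := by
  rw [Int.fract_eq_iff]
  refine ⟨by linarith, by linarith [Int.fract_lt_one (a - c), Int.fract_nonneg (a - b)],
    ⌊a - c⌋ - ⌊a - b⌋, ?_⟩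
  unfold Int.fract
  push_cast
  ring

theorem aux_CD_lt {a b d : ℝ} (ha : a ∈ Set.Ico (0:ℝ) 1) (hb : b ∈ Set.Ico (0:ℝ) 1)
    (hd : 0 < d) (h : Int.fract (a - b) < d ∨ Int.fract (b - a) < d) : CD a b < d := by
  by_cases hab : a = b
  · subst hab
    rwa [aux_CD_self]
  · rw [aux_CD ha hb hab]
    exact min_lt_iff.2 h

theorem aux_closer {S : Type*} [Fintype S] (f : S → ℝ)
    (hmem : ∀ s, f s ∈ Set.Ico (0:ℝ) 1) (hinj : Function.Injective f) (s t : S) (hst : s ≠ t) :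
    ∃ u, s ≠ u ∧ RingAdj (Set.range f) (f s) (f u) ∧ CD (f u) (f t) < CD (f s) (f t) := by
  classical
  have hne : (Finset.univ.filter (fun u : S => u ≠ s)).Nonempty := ⟨t, by simp [hst.symm]⟩
  have hf : f s ≠ f t := fun h => hst (hinj h)
  have hp1 := aux_pos (hmem s) (hmem t) hf
  have hp2 := aux_pos (hmem t) (hmem s) hf.symm
  rw [aux_CD (hmem s) (hmem t) hf]
  rcases le_total (Int.fract (f s - f t)) (Int.fract (f t - f s)) with hle | hle
  · rw [min_eq_left hle]
    obtain ⟨u, hu, hmin⟩ := Finset.exists_min_image _ (fun u => Int.fract (f s - f u)) hne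
    simp only [Finset.mem_filter, Finset.mem_univ, true_and] at hu hmin
    have hfu : f s ≠ f u := fun h => hu (hinj h).symm
    have hpu := aux_pos (hmem s) (hmem u) hfu
    refine ⟨u, hu.symm, ⟨⟨s, rfl⟩, ⟨u, rfl⟩, hfu, Or.inr ?_⟩, ?_⟩
    · rintro _ ⟨r, rfl⟩ ⟨h1, h2⟩
      have hr : r ≠ s := by
        rintro rfl
        exact lt_irrefl _ h2
      have h3 := hmin r hr
      have h4 := aux_sub _ _ _ h2.le
      linarith
    · refine aux_CD_lt (hmem u) (hmem t) hp1 (Or.inl ?_)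
      rw [aux_sub' _ _ _ (hmin t hst.symm)]
      linarith
  · rw [min_eq_right hle]
    obtain ⟨u, hu, hmin⟩ := Finset.exists_min_image _ (fun u => Int.fract (f u - f s)) hne
    simp only [Finset.mem_filter, Finset.mem_univ, true_and] at hu hmin
    have hfu : f s ≠ f u := fun h => hu (hinj h).symm
    have hpu := aux_pos (hmem u) (hmem s) hfu.symm
    refine ⟨u, hu.symm, ⟨⟨s, rfl⟩, ⟨u, rfl⟩, hfu, Or.inl ?_⟩, ?_⟩
    · rintro _ ⟨r, rfl⟩ ⟨h1, h2⟩
      have hr : r ≠ s := by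
        rintro rfl
        simp at h1
      linarith [hmin r hr]
    · refine aux_CD_lt (hmem u) (hmem t) hp2 (Or.inr ?_)
      rw [aux_sub _ _ _ (hmin t hst.symm)]
      linarith

/-- **Theorem: greediest routing.** In an S2 topology with `L ≥ 1` spaces,
any sequence of switches following greediest routing toward a destination switch `t`
(whenever the current switch differs from `t`, the next switch is a graph neighbor
minimizing the MCD to `χ(t)` among all graph neighbors) reaches `t` within
`|S| - 1` hops and visits pairwise distinct switches. -/
theorem stmt_2 {S : Type*} [Fintype S] {L : ℕ} (hL : 1 ≤ L)
    (χ : Fin L → S → ℝ)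
    (hmem : ∀ (i : Fin L) (s : S), χ i s ∈ Set.Ico (0 : ℝ) 1)
    (hinj : ∀ i : Fin L, Function.Injective (χ i))
    (G : SimpleGraph S)
    (hG : ∀ (i : Fin L) (u v : S), u ≠ v →
      RingAdj (Set.range (χ i)) (χ i u) (χ i v) → G.Adj u v)
    (t : S) (seq : ℕ → S)
    (hstep : ∀ j : ℕ, seq j ≠ t →
      G.Adj (seq j) (seq (j + 1)) ∧
      ∀ u : S, G.Adj (seq j) u →
        MCD (fun i => χ i (seq (j + 1))) (fun i => χ i t) ≤
          MCD (fun i => χ i u) (fun i => χ i t)) :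
    ∃ k : ℕ, k ≤ Fintype.card S - 1 ∧ seq k = t ∧
      ∀ j₁ j₂ : ℕ, j₁ ≤ k → j₂ ≤ k → seq j₁ = seq j₂ → j₁ = j₂ := by
  classical
  haveI : Nonempty (Fin L) := ⟨⟨0, hL⟩⟩
  set M : S → ℝ := fun s => MCD (fun i => χ i s) (fun i => χ i t) with hM
  have hdec : ∀ j, seq j ≠ t → M (seq (j + 1)) < M (seq j) := by
    intro j hj
    obtain ⟨i, hi⟩ := exists_eq_ciInf_of_finite (f := fun i => CD (χ i (seq j)) (χ i t))
    obtain ⟨u, hu, hadj, hlt⟩ := aux_closer (χ i) (hmem i) (hinj i) (seq j) t hj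
    have h1 := (hstep j hj).2 u (hG i _ _ hu hadj)
    have h2 : M u ≤ CD (χ i u) (χ i t) :=
      ciInf_le (f := fun i => CD (χ i u) (χ i t)) (Set.finite_range _).bddBelow i
    have h3 : M (seq j) = CD (χ i (seq j)) (χ i t) := hi.symm
    have h4 : M (seq (j + 1)) ≤ M u := h1
    linarith
  have hanti : ∀ k, (∀ j < k, seq j ≠ t) → ∀ b, b ≤ k → ∀ a, a < b →
      M (seq b) < M (seq a) := by
    intro k hk b
    induction b with
    | zero => intro _ a ha; omega
    | succ b ih =>
      intro hb a ha
      have h1 := hdec b (hk b (by omega))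
      rcases Nat.lt_succ_iff_lt_or_eq.1 ha with h | h
      · exact h1.trans (ih (by omega) a h)
      · rw [h]; exact h1
  have hinj' : ∀ k, (∀ j < k, seq j ≠ t) → ∀ j₁ j₂ : ℕ, j₁ ≤ k → j₂ ≤ k →
      seq j₁ = seq j₂ → j₁ = j₂ := by
    intro k hk j₁ j₂ h1 h2 he
    rcases lt_trichotomy j₁ j₂ with h | h | h
    · have := hanti k hk j₂ h2 j₁ h
      rw [he] at this
      exact absurd this (lt_irrefl _)
    · exact h
    · have := hanti k hk j₁ h1 j₂ h
      rw [he] at this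
      exact absurd this (lt_irrefl _)
  have hcard : 0 < Fintype.card S := Fintype.card_pos_iff.2 ⟨t⟩
  have hex : ∃ k, k ≤ Fintype.card S - 1 ∧ seq k = t := by
    by_contra hcon
    push Not at hcon
    have hi := hinj' (Fintype.card S) (fun j hj => hcon j (by omega))
    have := Fintype.card_le_of_injective (fun x : Fin (Fintype.card S + 1) => seq x)
      (fun x y hxy => Fin.ext (hi x y (by omega) (by omega) hxy))
    simp at this
  have hspec := Nat.find_spec hex
  refine ⟨Nat.find hex, hspec.1, hspec.2, hinj' _ ?_⟩
  intro j hj hjt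
  exact Nat.find_min hex hj ⟨by omega, hjt⟩
end

section
/- In an S2 topology with L spaces and switch set S, let d be an integer with 1 ≤ d ≤ L and let Y = ⟨y_1, …, y_d⟩ ∈ [0,1)^d be an arbitrary target coordinate vector. Let s_0, s_1, …, s_k be a walk in the graph such that MCD_d(χ(s_{j+1}), Y) < MCD_d(χ(s_j), Y) for every j < k, and such that no graph neighbor v of s_k satisfies MCD_d(χ(v), Y) < MCD_d(χ(s_k), Y). Then the switches s_0, …, s_k are pairwise distinct, and there exists a space r with 1 ≤ r ≤ d such that χ_r(s_k) attains the minimum of CD(χ_r(w), y_r) over all switches w ∈ S; that is, key-based greediest routing toward the hashed coordinates of a key terminates, without loops, at a home switch of the key. -/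
/-- `d`-MCD: minimum circular distance over the first `d` spaces, between an
`L`-dimensional coordinate vector `X` and a `d`-dimensional target `Y`. -/
noncomputable def MCDd {L : ℕ} (d : ℕ) (hd : d ≤ L) (X : Fin L → ℝ) (Y : Fin d → ℝ) : ℝ :=
  ⨅ i : Fin d, CD (X (Fin.castLE hd i)) (Y i)

/-- Explicit value of the fractional part of a difference of points of `[0,1)`. -/
lemma fract_sub_ico_s6 {p q : ℝ} (hp : p ∈ Set.Ico (0 : ℝ) 1) (hq : q ∈ Set.Ico (0 : ℝ) 1) :
    (q ≤ p ∧ Int.fract (p - q) = p - q) ∨ (p < q ∧ Int.fract (p - q) = p - q + 1) := by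
  obtain ⟨hp0, hp1⟩ := hp
  obtain ⟨hq0, hq1⟩ := hq
  rcases le_or_gt q p with h | h
  · left
    exact ⟨h, Int.fract_eq_self.2 ⟨by linarith, by linarith⟩⟩
  · right
    refine ⟨h, ?_⟩
    rw [← Int.fract_add_one]
    exact Int.fract_eq_self.2 ⟨by linarith, by linarith⟩

/-- Circular distance in terms of the fractional part, split into the two halves. -/
lemma CD_cases {p q : ℝ} (hp : p ∈ Set.Ico (0 : ℝ) 1) (hq : q ∈ Set.Ico (0 : ℝ) 1) :
    (Int.fract (p - q) ≤ 1 / 2 ∧ CD p q = Int.fract (p - q)) ∨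
      (1 / 2 < Int.fract (p - q) ∧ CD p q = 1 - Int.fract (p - q)) := by
  unfold CD
  rcases fract_sub_ico_s6 hp hq with ⟨h, e⟩ | ⟨h, e⟩ <;> rw [e]
  · rw [abs_of_nonneg (by linarith)]
    rcases le_or_gt (p - q) (1 / 2) with h' | h'
    · exact Or.inl ⟨h', min_eq_left (by linarith)⟩
    · exact Or.inr ⟨h', min_eq_right (by linarith)⟩
  · rw [abs_of_neg (by linarith)]
    rcases le_or_gt (p - q + 1) (1 / 2) with h' | h'
    · left
      refine ⟨h', ?_⟩
      rw [min_eq_right (by linarith)]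
      ring
    · right
      refine ⟨h', ?_⟩
      rw [min_eq_left (by linarith)]
      ring

/-- If some switch is strictly closer to `y` than `u`, then so is a ring neighbour of `u`. -/
lemma exists_ring_closer {S : Type*} [Fintype S] (f : S → ℝ)
    (hf : ∀ s, f s ∈ Set.Ico (0 : ℝ) 1) (hinj : Function.Injective f)
    {y : ℝ} (hy : y ∈ Set.Ico (0 : ℝ) 1) (u w : S) (hw : CD (f w) y < CD (f u) y) :
    ∃ v, u ≠ v ∧ RingAdj (Set.range f) (f u) (f v) ∧ CD (f v) y < CD (f u) y := by
  classical
  have hwu : w ≠ u := by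
    rintro rfl
    exact lt_irrefl _ hw
  have hne : (Finset.univ.filter (fun v : S => v ≠ u)).Nonempty := ⟨w, by simp [hwu]⟩
  rcases CD_cases (hf u) hy with ⟨hD, eD⟩ | ⟨hD, eD⟩
  · obtain ⟨v, hv, hmin⟩ := Finset.exists_min_image _ (fun v => Int.fract (f u - f v)) hne
    have hvu : v ≠ u := by simpa using hv
    have hfne : f v ≠ f u := fun h => hvu (hinj h)
    have hle : Int.fract (f u - f v) ≤ Int.fract (f u - f w) := hmin w (by simp [hwu])
    refine ⟨v, hvu.symm, ⟨⟨u, rfl⟩, ⟨v, rfl⟩, hfne.symm, Or.inr ?_⟩, ?_⟩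
    · rintro _ ⟨z, rfl⟩ ⟨h1, h2⟩
      have hzu : z ≠ u := by
        rintro rfl
        exact lt_irrefl _ h2
      have hm : Int.fract (f u - f v) ≤ Int.fract (f u - f z) := hmin z (by simp [hzu])
      have := hf u
      have := hf v
      have := hf z
      simp only [Set.mem_Ico] at *
      rcases fract_sub_ico_s6 (hf z) (hf v) with ⟨_, e1⟩ | ⟨_, e1⟩ <;>
      rcases fract_sub_ico_s6 (hf u) (hf v) with ⟨_, e2⟩ | ⟨_, e2⟩ <;>
      rcases fract_sub_ico_s6 (hf u) (hf z) with ⟨_, e3⟩ | ⟨_, e3⟩ <;>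
      rw [e1] at h1 h2 <;> rw [e2] at h2 hm <;> rw [e3] at hm <;> linarith
    · have a1 := hf u
      have a2 := hf v
      have a3 := hf w
      have a4 := hy
      simp only [Set.mem_Ico] at a1 a2 a3 a4
      have hlt : Int.fract (f u - f w) < 2 * Int.fract (f u - y) := by
        rw [eD] at hw
        rcases CD_cases (hf w) hy with ⟨h1, e1⟩ | ⟨h1, e1⟩ <;> rw [e1] at hw <;>
        rcases fract_sub_ico_s6 (hf w) hy with ⟨_, e2⟩ | ⟨_, e2⟩ <;>
        rcases fract_sub_ico_s6 (hf u) hy with ⟨_, e3⟩ | ⟨_, e3⟩ <;>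
        rcases fract_sub_ico_s6 (hf u) (hf w) with ⟨_, e4⟩ | ⟨_, e4⟩ <;>
        rw [e2] at hw h1 <;> rw [e3] at hw hD ⊢ <;> rw [e4] <;> linarith
      have hlt2 := lt_of_le_of_lt hle hlt
      clear hlt hle hmin hw
      rw [eD]
      rcases lt_or_gt_of_ne hfne with hlg | hlg <;>
      rcases CD_cases (hf v) hy with ⟨h1, e1⟩ | ⟨h1, e1⟩ <;> rw [e1] <;>
      rcases fract_sub_ico_s6 (hf v) hy with ⟨_, e2⟩ | ⟨_, e2⟩ <;>
      rcases fract_sub_ico_s6 (hf u) hy with ⟨_, e3⟩ | ⟨_, e3⟩ <;>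
      rcases fract_sub_ico_s6 (hf u) (hf v) with ⟨_, e4⟩ | ⟨_, e4⟩ <;>
      rw [e2] at h1 ⊢ <;> rw [e3] at hD hlt2 ⊢ <;> rw [e4] at hlt2 <;> linarith
  · obtain ⟨v, hv, hmin⟩ := Finset.exists_min_image _ (fun v => Int.fract (f v - f u)) hne
    have hvu : v ≠ u := by simpa using hv
    have hfne : f v ≠ f u := fun h => hvu (hinj h)
    have hle : Int.fract (f v - f u) ≤ Int.fract (f w - f u) := hmin w (by simp [hwu])
    refine ⟨v, hvu.symm, ⟨⟨u, rfl⟩, ⟨v, rfl⟩, hfne.symm, Or.inl ?_⟩, ?_⟩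
    · rintro _ ⟨z, rfl⟩ ⟨h1, h2⟩
      have hzu : z ≠ u := by
        rintro rfl
        simp at h1
      have hm : Int.fract (f v - f u) ≤ Int.fract (f z - f u) := hmin z (by simp [hzu])
      linarith
    · have a1 := hf u
      have a2 := hf v
      have a3 := hf w
      have a4 := hy
      simp only [Set.mem_Ico] at a1 a2 a3 a4
      have hlt : Int.fract (f w - f u) < 2 * (1 - Int.fract (f u - y)) := by
        rw [eD] at hw
        rcases CD_cases (hf w) hy with ⟨h1, e1⟩ | ⟨h1, e1⟩ <;> rw [e1] at hw <;>
        rcases fract_sub_ico_s6 (hf w) hy with ⟨_, e2⟩ | ⟨_, e2⟩ <;>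
        rcases fract_sub_ico_s6 (hf u) hy with ⟨_, e3⟩ | ⟨_, e3⟩ <;>
        rcases fract_sub_ico_s6 (hf w) (hf u) with ⟨_, e4⟩ | ⟨_, e4⟩ <;>
        rw [e2] at hw h1 <;> rw [e3] at hw hD ⊢ <;> rw [e4] <;> linarith
      have hlt2 := lt_of_le_of_lt hle hlt
      clear hlt hle hmin hw
      rw [eD]
      rcases lt_or_gt_of_ne hfne with hlg | hlg <;>
      rcases CD_cases (hf v) hy with ⟨h1, e1⟩ | ⟨h1, e1⟩ <;> rw [e1] <;>
      rcases fract_sub_ico_s6 (hf v) hy with ⟨_, e2⟩ | ⟨_, e2⟩ <;>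
      rcases fract_sub_ico_s6 (hf u) hy with ⟨_, e3⟩ | ⟨_, e3⟩ <;>
      rcases fract_sub_ico_s6 (hf v) (hf u) with ⟨_, e4⟩ | ⟨_, e4⟩ <;>
      rw [e2] at h1 ⊢ <;> rw [e3] at hD hlt2 ⊢ <;> rw [e4] at hlt2 <;> linarith

/-- In an S2 topology with `L` spaces, let `1 ≤ d ≤ L` and let
`Y ∈ [0,1)^d` be a target coordinate vector. Any walk along which the `d`-MCD to `Y`
strictly decreases at every hop, and which is maximal (no graph neighbor of the last
switch has strictly smaller `d`-MCD to `Y`), visits pairwise distinct switches and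
terminates at a home switch of `Y`: in some space `r ≤ d` the last switch's coordinate
attains the minimum circular distance to `y_r` among all switches. -/
theorem stmt_6 {S : Type*} [Fintype S] {L : ℕ}
    (χ : Fin L → S → ℝ)
    (hmem : ∀ (i : Fin L) (s : S), χ i s ∈ Set.Ico (0 : ℝ) 1)
    (hinj : ∀ i : Fin L, Function.Injective (χ i))
    (G : SimpleGraph S)
    (hG : ∀ (i : Fin L) (u v : S), u ≠ v →
      RingAdj (Set.range (χ i)) (χ i u) (χ i v) → G.Adj u v)
    (d : ℕ) (hd1 : 1 ≤ d) (hd2 : d ≤ L)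
    (Y : Fin d → ℝ) (hY : ∀ i : Fin d, Y i ∈ Set.Ico (0 : ℝ) 1)
    (k : ℕ) (seq : ℕ → S)
    (hwalk : ∀ j < k, G.Adj (seq j) (seq (j + 1)))
    (hdec : ∀ j < k,
      MCDd d hd2 (fun i => χ i (seq (j + 1))) Y < MCDd d hd2 (fun i => χ i (seq j)) Y)
    (hmax : ∀ v : S, G.Adj (seq k) v →
      ¬ MCDd d hd2 (fun i => χ i v) Y < MCDd d hd2 (fun i => χ i (seq k)) Y) :
    (∀ j₁ j₂ : ℕ, j₁ ≤ k → j₂ ≤ k → seq j₁ = seq j₂ → j₁ = j₂) ∧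
      ∃ r : Fin d, ∀ w : S,
        CD (χ (Fin.castLE hd2 r) (seq k)) (Y r) ≤ CD (χ (Fin.castLE hd2 r) w) (Y r) := by
  constructor
  · have key : ∀ a b : ℕ, a < b → b ≤ k →
        MCDd d hd2 (fun i => χ i (seq b)) Y < MCDd d hd2 (fun i => χ i (seq a)) Y := by
      intro a b hab
      induction b, hab using Nat.le_induction with
      | base => exact fun h => hdec a (by omega)
      | succ n hn ih => exact fun h => lt_trans (hdec n (by omega)) (ih (by omega))
    intro a b ha hb hab
    rcases lt_trichotomy a b with h | h | h
    · have := key a b h hb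
      rw [hab] at this
      exact absurd this (lt_irrefl _)
    · exact h
    · have := key b a h ha
      rw [hab] at this
      exact absurd this (lt_irrefl _)
  · haveI : Nonempty (Fin d) := ⟨⟨0, hd1⟩⟩
    obtain ⟨r, hr⟩ := exists_eq_ciInf_of_finite
      (f := fun i : Fin d => CD (χ (Fin.castLE hd2 i) (seq k)) (Y i))
    refine ⟨r, fun w => ?_⟩
    by_contra hcon
    push Not at hcon
    obtain ⟨v, huv, hadj, hlt⟩ := exists_ring_closer (χ (Fin.castLE hd2 r))
      (hmem _) (hinj _) (hY r) (seq k) w hcon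
    refine hmax v (hG _ _ _ huv hadj) ?_
    unfold MCDd
    rw [← hr]
    exact lt_of_le_of_lt (ciInf_le (Set.finite_range _).bddBelow r) hlt
end

section
/- In an S2 topology with L ≥ 1 spaces, let s and t be distinct switches and let v be a switch minimizing MCD(χ(·), χ(t)) among all switches at graph distance at most 2 from s (the 1-hop and 2-hop neighbors of s, including s itself). Then MCD(χ(v), χ(t)) < MCD(χ(s), χ(t)); in particular v ≠ s, so greedy forwarding that considers both 1-hop and 2-hop neighbors always finds a switch within two hops that is strictly closer in MCD to the destination. -/
theorem fr_eq {x y : ℝ} (hx : x ∈ Set.Ico (0:ℝ) 1) (hy : y ∈ Set.Ico (0:ℝ) 1) :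
    Int.fract (x - y) = if y ≤ x then x - y else x - y + 1 := by
  obtain ⟨hx0, hx1⟩ := hx
  obtain ⟨hy0, hy1⟩ := hy
  split_ifs with h
  · rw [Int.fract_eq_iff]
    exact ⟨by linarith, by linarith, 0, by simp⟩
  · push Not at h
    rw [Int.fract_eq_iff]
    exact ⟨by linarith, by linarith, -1, by push_cast; ring⟩

theorem CD_eq {x y : ℝ} (hx : x ∈ Set.Ico (0:ℝ) 1) (hy : y ∈ Set.Ico (0:ℝ) 1) (hne : x ≠ y) :
    CD x y = min (Int.fract (x - y)) (Int.fract (y - x)) := by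
  rw [fr_eq hx hy, fr_eq hy hx, CD]
  rcases lt_or_gt_of_ne hne with h | h
  · rw [if_neg (not_le.2 h), if_pos h.le, abs_of_neg (by linarith), min_comm]
    congr 1 <;> ring
  · rw [if_pos h.le, if_neg (not_le.2 h), abs_of_pos (by linarith)]
    congr 1; ring

theorem CD_le {x y : ℝ} (hx : x ∈ Set.Ico (0:ℝ) 1) (hy : y ∈ Set.Ico (0:ℝ) 1) :
    CD x y ≤ Int.fract (x - y) ∧ CD x y ≤ Int.fract (y - x) := by
  by_cases h : x = y
  · subst h; simp [CD]
  · rw [CD_eq hx hy h]; exact ⟨min_le_left _ _, min_le_right _ _⟩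

theorem key {S : Type*} [Fintype S] (c : S → ℝ) (hmem : ∀ s, c s ∈ Set.Ico (0 : ℝ) 1)
    (hinj : Function.Injective c) (s t : S) (hst : s ≠ t) :
    ∃ u, u ≠ s ∧ RingAdj (Set.range c) (c s) (c u) ∧ CD (c u) (c t) < CD (c s) (c t) := by
  classical
  have hne : (Finset.univ.filter (fun u : S => u ≠ s)).Nonempty := ⟨t, by simpa using hst.symm⟩
  rcases le_total (Int.fract (c s - c t)) (Int.fract (c t - c s)) with h | h
  · obtain ⟨u, hu, hmin⟩ := Finset.exists_min_image _ (fun u => Int.fract (c s - c u)) hne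
    have hus : u ≠ s := by simpa using hu
    have hcu : c u ≠ c s := fun e => hus (hinj e)
    refine ⟨u, hus, ⟨⟨s, rfl⟩, ⟨u, rfl⟩, hcu.symm, Or.inr ?_⟩, ?_⟩
    · rintro _ ⟨r, rfl⟩ ⟨h1, h2⟩
      by_cases hr : r = s
      · subst hr; exact lt_irrefl _ h2
      have := hmin r (by simpa using hr)
      obtain ⟨_, _⟩ := hmem r
      obtain ⟨_, _⟩ := hmem s
      obtain ⟨_, _⟩ := hmem u
      simp only [fr_eq (hmem _) (hmem _)] at this h1 h2
      split_ifs at this h1 h2 <;> first | linarith | grind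
    · have := hmin t (by simpa using hst.symm)
      rw [CD_eq (hmem s) (hmem t) (fun e => hst (hinj e)), min_eq_left h]
      refine lt_of_le_of_lt (CD_le (hmem u) (hmem t)).1 ?_
      simp only [fr_eq (hmem _) (hmem _)] at this ⊢
      obtain ⟨_, _⟩ := hmem t
      obtain ⟨_, _⟩ := hmem s
      obtain ⟨_, _⟩ := hmem u
      split_ifs at this ⊢ <;> grind
  · obtain ⟨u, hu, hmin⟩ := Finset.exists_min_image _ (fun u => Int.fract (c u - c s)) hne
    have hus : u ≠ s := by simpa using hu
    have hcu : c u ≠ c s := fun e => hus (hinj e)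
    refine ⟨u, hus, ⟨⟨s, rfl⟩, ⟨u, rfl⟩, hcu.symm, Or.inl ?_⟩, ?_⟩
    · rintro _ ⟨r, rfl⟩ ⟨h1, h2⟩
      by_cases hr : r = s
      · subst hr; simp at h1
      exact absurd (hmin r (by simpa using hr)) (not_le.2 h2)
    · have := hmin t (by simpa using hst.symm)
      rw [CD_eq (hmem s) (hmem t) (fun e => hst (hinj e)), min_eq_right h]
      refine lt_of_le_of_lt (CD_le (hmem u) (hmem t)).2 ?_
      simp only [fr_eq (hmem _) (hmem _)] at this ⊢
      obtain ⟨_, _⟩ := hmem t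
      obtain ⟨_, _⟩ := hmem s
      obtain ⟨_, _⟩ := hmem u
      split_ifs at this ⊢ <;> grind

/-- In an S2 topology with `L ≥ 1` spaces, let `s ≠ t` and let `v`
minimize the MCD to `χ(t)` among all switches at graph distance at most 2 from `s`
(i.e. all switches reachable from `s` by a walk of length at most 2, including `s`
itself). Then `MCD (χ v) (χ t) < MCD (χ s) (χ t)`; in particular `v ≠ s`. -/
theorem stmt_7 {S : Type*} [Fintype S] {L : ℕ} (hL : 1 ≤ L)
    (χ : Fin L → S → ℝ)
    (hmem : ∀ (i : Fin L) (s : S), χ i s ∈ Set.Ico (0 : ℝ) 1)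
    (hinj : ∀ i : Fin L, Function.Injective (χ i))
    (G : SimpleGraph S)
    (hG : ∀ (i : Fin L) (u v : S), u ≠ v →
      RingAdj (Set.range (χ i)) (χ i u) (χ i v) → G.Adj u v)
    (s t : S) (hst : s ≠ t)
    (v : S) (hv : ∃ p : G.Walk s v, p.length ≤ 2)
    (hvmin : ∀ u : S, (∃ p : G.Walk s u, p.length ≤ 2) →
      MCD (fun i => χ i v) (fun i => χ i t) ≤ MCD (fun i => χ i u) (fun i => χ i t)) :
    MCD (fun i => χ i v) (fun i => χ i t) < MCD (fun i => χ i s) (fun i => χ i t) ∧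
      v ≠ s := by
  have : Nonempty (Fin L) := ⟨⟨0, hL⟩⟩
  have main : MCD (fun i => χ i v) (fun i => χ i t) < MCD (fun i => χ i s) (fun i => χ i t) := by
    obtain ⟨i, hi⟩ := exists_eq_ciInf_of_finite (f := fun i => CD (χ i s) (χ i t))
    obtain ⟨u, hus, hadj, hlt⟩ := key (χ i) (hmem i) (hinj i) s t hst
    have hA : G.Adj s u := hG i s u hus.symm hadj
    refine lt_of_le_of_lt (hvmin u ⟨hA.toWalk, by simp⟩) ?_
    unfold MCD
    rw [← hi]
    exact lt_of_le_of_lt (ciInf_le (Set.finite_range _).bddBelow i) hlt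
  refine ⟨main, ?_⟩
  rintro rfl
  exact lt_irrefl _ main
end

section
/- Let x_1, x_2, …, x_n ∈ [0,1) (n ≥ 2) be pairwise distinct points constructed sequentially such that for every k with 1 ≤ k ≤ n − 1, the new point x_{k+1} has circular distance at least 1/(3k) to each point of {x_1, …, x_k} that is circularly adjacent to x_{k+1} in the set {x_1, …, x_k, x_{k+1}}. Then for all i ≠ j, CD(x_i, x_j) ≥ 1/(3n); that is, the balanced random coordinate generation algorithm guarantees that the circular distance between the coordinates of any pair of the n switches in a space is no less than 1/(3n). -/
theorem fract_pos_case (p q : ℝ) (hp : p ∈ Set.Ico (0 : ℝ) 1) (hq : q ∈ Set.Ico (0 : ℝ) 1)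
    (h : q ≤ p) : Int.fract (p - q) = p - q :=
  Int.fract_eq_self.mpr ⟨by linarith, by linarith [hp.2, hq.1]⟩

theorem fract_neg_case (p q : ℝ) (hp : p ∈ Set.Ico (0 : ℝ) 1) (hq : q ∈ Set.Ico (0 : ℝ) 1)
    (h : p < q) : Int.fract (p - q) = 1 + (p - q) := by
  rw [Int.fract_eq_iff]
  exact ⟨by linarith [hp.1, hq.2], by linarith, -1, by push_cast; ring⟩

theorem CD_eq_s10 (p q : ℝ) (hp : p ∈ Set.Ico (0 : ℝ) 1) (hq : q ∈ Set.Ico (0 : ℝ) 1)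
    (h : p ≠ q) : CD p q = min (Int.fract (p - q)) (Int.fract (q - p)) := by
  unfold CD
  rcases lt_or_gt_of_ne h with h | h
  · rw [fract_neg_case p q hp hq h, fract_pos_case q p hq hp h.le, abs_of_neg (by linarith),
      min_comm]
    congr 1 <;> ring
  · rw [fract_neg_case q p hq hp h, fract_pos_case p q hp hq h.le, abs_of_pos (by linarith)]
    congr 1; ring

theorem CD_symm (p q : ℝ) : CD p q = CD q p := by
  unfold CD; rw [abs_sub_comm]

theorem main_aux (n : ℕ) (x : ℕ → ℝ)
    (hmem : ∀ i < n, x i ∈ Set.Ico (0 : ℝ) 1)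
    (hdist : ∀ i < n, ∀ j < n, i ≠ j → x i ≠ x j)
    (hstep : ∀ k : ℕ, 1 ≤ k → k ≤ n - 1 → ∀ j < k,
      RingAdj (x '' {i : ℕ | i ≤ k}) (x k) (x j) →
      1 / (3 * (k : ℝ)) ≤ CD (x k) (x j)) (i : ℕ) (hi : i < n) (j : ℕ) (hj : j < i) :
    1 / (3 * (n : ℝ)) ≤ CD (x i) (x j) := by
  have hi0 : (0 : ℝ) < i := by exact_mod_cast (by omega : 0 < i)
  have hin : (i : ℝ) ≤ n := by exact_mod_cast hi.le
  have h1 : 1 / (3 * (n : ℝ)) ≤ 1 / (3 * (i : ℝ)) :=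
    one_div_le_one_div_of_le (by linarith) (by linarith)
  refine h1.trans ?_
  have hne : (Finset.range i).Nonempty := ⟨j, Finset.mem_range.mpr hj⟩
  rw [CD_eq_s10 _ _ (hmem i hi) (hmem j (hj.trans hi)) (hdist i hi j (hj.trans hi) hj.ne')]
  refine le_min ?_ ?_
  · obtain ⟨m, hm, hmin⟩ := Finset.exists_min_image (Finset.range i)
      (fun m => Int.fract (x i - x m)) hne
    have hmi := Finset.mem_range.mp hm
    have hd := hdist i hi m (hmi.trans hi) hmi.ne'
    have := hstep i (by omega) (by omega) m hmi
      ⟨⟨i, le_refl i, rfl⟩, ⟨m, hmi.le, rfl⟩, hd, Or.inr ?_⟩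
    · rw [CD_eq_s10 _ _ (hmem i hi) (hmem m (hmi.trans hi)) hd] at this
      exact (this.trans (min_le_left _ _)).trans (hmin j (Finset.mem_range.mpr hj))
    · rintro r ⟨l, hl, rfl⟩ ⟨ha, hb⟩
      rcases (show l ≤ i from hl).eq_or_lt with rfl | hl
      · exact lt_irrefl _ hb
      · have hc := hmin l (Finset.mem_range.mpr hl)
        have e : Int.fract (x i - x l) = Int.fract (x i - x m) - Int.fract (x l - x m) := by
          rw [Int.fract_eq_iff]
          refine ⟨by linarith, by linarith [Int.fract_lt_one (x i - x m)],
            ⌊x i - x m⌋ - ⌊x l - x m⌋, ?_⟩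
          simp only [Int.fract]; push_cast; ring
        linarith
  · obtain ⟨m, hm, hmin⟩ := Finset.exists_min_image (Finset.range i)
      (fun m => Int.fract (x m - x i)) hne
    have hmi := Finset.mem_range.mp hm
    have hd := hdist i hi m (hmi.trans hi) hmi.ne'
    have := hstep i (by omega) (by omega) m hmi
      ⟨⟨i, le_refl i, rfl⟩, ⟨m, hmi.le, rfl⟩, hd, Or.inl ?_⟩
    · rw [CD_eq_s10 _ _ (hmem i hi) (hmem m (hmi.trans hi)) hd] at this
      exact (this.trans (min_le_right _ _)).trans (hmin j (Finset.mem_range.mpr hj))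
    · rintro r ⟨l, hl, rfl⟩ ⟨ha, hb⟩
      rcases (show l ≤ i from hl).eq_or_lt with rfl | hl
      · simp at ha
      · exact absurd hb (not_lt.mpr (hmin l (Finset.mem_range.mpr hl)))

/-- Let `x 0, …, x (n-1) ∈ [0,1)` (`n ≥ 2`) be pairwise distinct
points constructed sequentially such that for every `k` with `1 ≤ k ≤ n - 1`, the new
point `x k` has circular distance at least `1/(3k)` to each earlier point that is
circularly adjacent to it in `{x 0, …, x k}`. Then the circular distance between any
two of the `n` points is at least `1/(3n)`. -/
theorem stmt_10 (n : ℕ) (hn : 2 ≤ n) (x : ℕ → ℝ)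
    (hmem : ∀ i < n, x i ∈ Set.Ico (0 : ℝ) 1)
    (hdist : ∀ i < n, ∀ j < n, i ≠ j → x i ≠ x j)
    (hstep : ∀ k : ℕ, 1 ≤ k → k ≤ n - 1 → ∀ j < k,
      RingAdj (x '' {i : ℕ | i ≤ k}) (x k) (x j) →
      1 / (3 * (k : ℝ)) ≤ CD (x k) (x j)) :
    ∀ i < n, ∀ j < n, i ≠ j → 1 / (3 * (n : ℝ)) ≤ CD (x i) (x j) := by
  intro i hi j hj hij
  rcases lt_or_gt_of_ne hij with h | h
  · rw [CD_symm]
    exact main_aux n x hmem hdist hstep j hj i h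
  · exact main_aux n x hmem hdist hstep i hi j h
end
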